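/- Define, for b > 1 and r > 0, E_b(r) = 1 - (2 log b / √(2π)) · r · Σ_{ℓ ∈ ℤ} b^{-ℓ} exp(-r²/(2 b^{2ℓ})). Then for every ε > 0 there exists δ > 0 such that for all b with 1 < b < 1 + δ and all r > 0, |E_b(r)| ≤ (2√2 + ε) · exp(-π²/(2 log b)). -/

import Mathlib

open Filter Asymptotics Topology FourierTransform


lemma bsa_gamma (y : ℝ) : ‖Complex.Gamma (1/2 + y * Complex.I)‖ ≤
    Real.sqrt Real.pi * (Real.sqrt 2 * Real.exp (-(Real.pi * |y| / 2))) := by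
  have h1 : ‖Complex.Gamma (1/2 + y * Complex.I)‖ ^ 2 = Real.pi / Real.cosh (Real.pi * y) := by
    have h := Complex.Gamma_mul_Gamma_one_sub (1/2 + y * Complex.I)
    have e : (1 : ℂ) - (1/2 + y * Complex.I) = (starRingEnd ℂ) (1/2 + y * Complex.I) := by
      simp [Complex.ext_iff]; norm_num
    rw [e, Complex.Gamma_conj, Complex.mul_conj, Complex.normSq_eq_norm_sq] at h
    have e2 : Complex.sin (Real.pi * (1/2 + y * Complex.I)) = (Real.cosh (Real.pi * y) : ℝ) := by
      rw [show (Real.pi * (1/2 + y * Complex.I) : ℂ) = (Real.pi * y : ℝ) * Complex.I + Real.pi / 2 by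
        push_cast; ring, Complex.sin_add_pi_div_two, Complex.cos_mul_I, Complex.ofReal_cosh]
    rw [e2] at h
    exact_mod_cast h
  have h2 : Real.exp (Real.pi * |y|) / 2 ≤ Real.cosh (Real.pi * y) := by
    rw [← Real.cosh_abs, abs_mul, abs_of_pos Real.pi_pos, Real.cosh_eq]
    have := Real.exp_pos (-(Real.pi * |y|))
    linarith
  refine (sq_le_sq₀ (norm_nonneg _) (by positivity)).1 ?_
  rw [h1, mul_pow, mul_pow, Real.sq_sqrt Real.pi_pos.le, Real.sq_sqrt (by norm_num), ← Real.exp_nat_mul,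
    show ((2:ℕ):ℝ) * -(Real.pi * |y| / 2) = -(Real.pi * |y|) by push_cast; ring, Real.exp_neg]
  have hpi := Real.pi_pos
  calc Real.pi / Real.cosh (Real.pi * y) ≤ Real.pi / (Real.exp (Real.pi * |y|) / 2) := by
        gcongr
    _ = _ := by field_simp

lemma bsa_mellin (c : ℝ) (hc : 0 < c) (s : ℂ) (hs : 0 < s.re) :
    mellin (fun u : ℝ => ((Real.exp (-(c * u ^ 2)) : ℝ) : ℂ)) s =
      (1 / 2 : ℂ) * ((c : ℂ) ^ (-(s / 2)) * Complex.Gamma (s / 2)) := by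
  have h := mellin_comp_rpow (fun y : ℝ => ((Real.exp (-(c * y)) : ℝ) : ℂ)) s 2
  have h' := mellin_comp_mul_left (fun y : ℝ => ((Real.exp (-y) : ℝ) : ℂ)) (s / 2) hc
  simp only [Real.rpow_two, Complex.ofReal_ofNat] at h
  rw [h, h', ← Complex.GammaIntegral_eq_mellin, ← Complex.Gamma_eq_integral (by simpa using hs)]
  simp

/-- The summand as a function of a real variable. -/
noncomputable def bsaF (c h : ℝ) (t : ℝ) : ℂ :=
  ((Real.exp (-(h * t)) * Real.exp (-(c * Real.exp (-(h * t)) ^ 2)) : ℝ) : ℂ)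

lemma bsa_fourier (c h : ℝ) (hc : 0 < c) (hh : 0 < h) (n : ℝ) :
    𝓕 (bsaF c h) n = (1 / h : ℂ) * ((1 / 2 : ℂ) *
      ((c : ℂ) ^ (-(1 / 2 + (Real.pi * n / h : ℝ) * Complex.I)) *
        Complex.Gamma (1 / 2 + (Real.pi * n / h : ℝ) * Complex.I))) := by
  have h1 := bsa_mellin c hc (1 + (2 * Real.pi * n / h : ℝ) * Complex.I) (by simp)
  rw [mellin_eq_fourier] at h1
  have e : (1 + (2 * Real.pi * n / h : ℝ) * Complex.I) / 2 =
    (1 / 2 + (Real.pi * n / h : ℝ) * Complex.I) := by push_cast; ring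
  rw [e] at h1
  rw [← h1]
  have e2 : (1 + (2 * Real.pi * n / h : ℝ) * Complex.I).im / (2 * Real.pi) = n / h := by
    have := Real.pi_ne_zero
    simp; field_simp
  rw [e2, Real.fourier_real_eq, Real.fourier_real_eq]
  have := MeasureTheory.Measure.integral_comp_mul_left (fun v : ℝ => Real.fourierChar (-(v * (n / h))) •
    (Real.exp (-(1 + (2 * Real.pi * n / h : ℝ) * Complex.I).re * v) •
      ((Real.exp (-(c * Real.exp (-v) ^ 2)) : ℝ) : ℂ))) h
  rw [abs_of_pos (inv_pos.2 hh), Complex.real_smul] at this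
  rw [show (1 / h : ℂ) = ((h⁻¹ : ℝ) : ℂ) by simp, ← this]
  congr 1
  ext v
  have e3 : h * v * (n / h) = v * n := by field_simp
  rw [e3]
  simp [bsaF]

lemma bsa_cont (c h : ℝ) : Continuous (bsaF c h) := by
  unfold bsaF; fun_prop

lemma bsa_decay (c h : ℝ) (hc : 0 < c) (hh : 0 < h) :
    bsaF c h =O[cocompact ℝ] fun x : ℝ => |x| ^ (-(2:ℝ)) := by
  have h1 : bsaF c h =O[cocompact ℝ] fun x : ℝ => Real.exp (-h * |x|) := by
    refine IsBigO.of_bound (1 + 1 / c) (Eventually.of_forall fun t => ?_)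
    rw [bsaF, Complex.norm_real, Real.norm_of_nonneg (by positivity), Real.norm_of_nonneg (by positivity)]
    have hi : 0 < 1 / c := by positivity
    rcases le_total 0 t with ht | ht
    · rw [abs_of_nonneg ht, neg_mul]
      have : Real.exp (-(c * Real.exp (-(h * t)) ^ 2)) ≤ 1 := Real.exp_le_one_iff.2 (by simp; positivity)
      nlinarith [Real.exp_pos (-(h * t))]
    · rw [abs_of_nonpos ht]
      set u := Real.exp (-(h * t)) with hu
      have hup : 0 < u := Real.exp_pos _
      have e : Real.exp (-h * -t) = u⁻¹ := by rw [hu, ← Real.exp_neg]; ring_nf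
      have : Real.exp (-(c * u ^ 2)) ≤ 1 / (c * u ^ 2) := by
        rw [Real.exp_neg, ← one_div]
        apply one_div_le_one_div_of_le (by positivity)
        linarith [Real.add_one_le_exp (c * u ^ 2)]
      rw [e]
      calc u * Real.exp (-(c * u ^ 2)) ≤ u * (1 / (c * u ^ 2)) := by gcongr
        _ = (1 / c) * u⁻¹ := by field_simp
        _ ≤ _ := by gcongr; linarith
  refine h1.trans ?_
  have := (isLittleO_exp_neg_mul_rpow_atTop hh (-2)).isBigO.comp_tendsto (tendsto_norm_cocompact_atTop (E := ℝ))
  exact this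

lemma bsa_hasSum (q : ℝ) (hq0 : 0 ≤ q) (hq1 : q < 1) :
    HasSum (fun n : ℤ => if n = 0 then 0 else Real.sqrt 2 * q ^ n.natAbs)
      (2 * Real.sqrt 2 * (q / (1 - q))) := by
  have hg := (((hasSum_geometric_of_lt_one hq0 hq1).mul_left q).mul_left (Real.sqrt 2))
  have e : 2 * Real.sqrt 2 * (q / (1 - q)) =
      Real.sqrt 2 * (q * (1 - q)⁻¹) + Real.sqrt 2 * (q * (1 - q)⁻¹) := by
    rw [div_eq_mul_inv]; ring
  rw [e]
  apply HasSum.of_nat_of_neg_add_one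
  · rw [← hasSum_nat_add_iff' 1]
    simp only [Finset.range_one, Finset.sum_singleton, Nat.cast_zero, if_true, sub_zero]
    refine hg.congr_fun ?_ |> fun h => h
    intro n
    rw [if_neg (by omega), Int.natAbs_natCast, pow_succ']
  · refine hg.congr_fun ?_ |> fun h => h
    intro n
    rw [if_neg (by omega), show (-((n:ℤ) + 1)).natAbs = n + 1 by omega, pow_succ']

lemma bsa_main (b : ℝ) (hb : 1 < b) (r : ℝ) (hr : 0 < r) :
    |1 - (2 * Real.log b / Real.sqrt (2 * Real.pi)) * r *
          ∑' ℓ : ℤ, b ^ (-ℓ) * Real.exp (-(r ^ 2 / (2 * b ^ (2 * ℓ))))| ≤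
      2 * Real.sqrt 2 * (Real.exp (-(Real.pi ^ 2 / (2 * Real.log b))) /
        (1 - Real.exp (-(Real.pi ^ 2 / (2 * Real.log b))))) := by
  have hpi := Real.pi_pos
  have hb0 : 0 < b := by linarith
  set h := Real.log b with hh'
  have hh : 0 < h := Real.log_pos hb
  set q := Real.exp (-(Real.pi ^ 2 / (2 * h))) with hq
  have hq0 : 0 ≤ q := (Real.exp_pos _).le
  have hq1 : q < 1 := by
    rw [hq, Real.exp_lt_one_iff]
    have : 0 < Real.pi ^ 2 / (2 * h) := by positivity
    linarith
  set A := 2 * h / Real.sqrt (2 * Real.pi) * r with hA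
  have hA0 : 0 < A := by positivity
  set c := r ^ 2 / 2 with hc'
  have hc : 0 < c := by positivity
  have hAc : A * ((1 / h) * ((1 / 2) * c ^ (-(1/2) : ℝ))) = 1 / Real.sqrt Real.pi := by
    rw [Real.rpow_neg hc.le, ← Real.sqrt_eq_rpow, hc', hA, Real.sqrt_div (by positivity),
      Real.sqrt_sq hr.le, Real.sqrt_mul (by norm_num)]
    field_simp
  have hB := bsa_hasSum q hq0 hq1
  have hbound : ∀ n : ℤ, ‖(A : ℂ) * 𝓕 (bsaF c h) n‖ ≤ Real.sqrt 2 * q ^ n.natAbs := by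
    intro n
    rw [bsa_fourier c h hc hh, norm_mul, norm_mul, norm_mul, norm_mul,
      Complex.norm_cpow_eq_rpow_re_of_pos hc]
    have hG := bsa_gamma (Real.pi * n / h)
    have e1 : (-(1 / 2 + ((Real.pi * n / h : ℝ) : ℂ) * Complex.I)).re = -(1/2) := by simp
    have e2 : ‖(A : ℂ)‖ = A := by rw [Complex.norm_real, Real.norm_of_nonneg hA0.le]
    have e3 : ‖(1 / h : ℂ)‖ = 1 / h := by
      rw [norm_div, Complex.norm_real, Real.norm_of_nonneg hh.le]; simp
    have e4 : ‖(1 / 2 : ℂ)‖ = 1 / 2 := by simp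
    rw [e1, e2, e3, e4]
    have e5 : Real.exp (-(Real.pi * |Real.pi * n / h| / 2)) = q ^ n.natAbs := by
      rw [hq, ← Real.exp_nat_mul, abs_div, abs_mul, abs_of_pos hpi, abs_of_pos hh,
        Nat.cast_natAbs, Int.cast_abs]
      congr 1
      field_simp
    rw [e5] at hG
    have hs : 0 < Real.sqrt Real.pi := by positivity
    calc _ = (A * ((1 / h) * ((1 / 2) * c ^ (-(1/2) : ℝ)))) *
          ‖Complex.Gamma (1/2 + (Real.pi * n / h : ℝ) * Complex.I)‖ := by ring
      _ ≤ (1 / Real.sqrt Real.pi) * (Real.sqrt Real.pi * (Real.sqrt 2 * q ^ n.natAbs)) := by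
        rw [hAc]; gcongr
      _ = _ := by field_simp
  have hzero : (A : ℂ) * 𝓕 (bsaF c h) ((0 : ℤ) : ℝ) = 1 := by
    rw [bsa_fourier c h hc hh]
    have e : (1 / 2 + ((Real.pi * ((0:ℤ):ℝ) / h : ℝ) : ℂ) * Complex.I) = 1 / 2 := by simp
    rw [e, Complex.Gamma_one_half_eq]
    have hs : 0 < Real.sqrt Real.pi := by positivity
    have e2 : (Real.pi : ℂ) ^ (1 / 2 : ℂ) = ((Real.sqrt Real.pi : ℝ) : ℂ) := by
      rw [Real.sqrt_eq_rpow, Complex.ofReal_cpow hpi.le]; simp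
    have e3 : (c : ℂ) ^ (-(1 / 2) : ℂ) = ((c ^ (-(1/2) : ℝ) : ℝ) : ℂ) := by
      rw [Complex.ofReal_cpow hc.le]; simp
    rw [e2, e3]
    have : (A * ((1 / h) * ((1 / 2) * c ^ (-(1/2) : ℝ)))) * Real.sqrt Real.pi = 1 := by
      rw [hAc]; field_simp
    have h3 := congrArg (fun x : ℝ => (x : ℂ)) this
    push_cast at h3 ⊢
    refine Eq.trans ?_ h3; ring
  have hT : ∀ n : ℤ, ‖(if n = 0 then 0 else (A : ℂ) * 𝓕 (bsaF c h) n : ℂ)‖ ≤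
      if n = 0 then 0 else Real.sqrt 2 * q ^ n.natAbs := by
    intro n
    split_ifs with h0
    · simp
    · exact hbound n
  have hTs : Summable (fun n : ℤ => (if n = 0 then 0 else (A : ℂ) * 𝓕 (bsaF c h) n : ℂ)) :=
    Summable.of_norm_bounded hB.summable hT
  have hsum1 : HasSum (fun n : ℤ => (A : ℂ) * 𝓕 (bsaF c h) n)
      (1 + ∑' n : ℤ, (if n = 0 then 0 else (A : ℂ) * 𝓕 (bsaF c h) n : ℂ)) := by
    have := (hasSum_ite_eq (0 : ℤ) (1 : ℂ)).add hTs.hasSum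
    convert this using 2 with n
    by_cases h0 : n = 0
    · subst h0; rw [hzero]; simp
    · simp [h0]
  have hAne : (A : ℂ) ≠ 0 := by exact_mod_cast hA0.ne'
  have hFs : Summable (fun n : ℤ => 𝓕 (bsaF c h) n) :=
    (summable_mul_left_iff hAne).1 hsum1.summable
  have hP := Real.tsum_eq_tsum_fourier_of_rpow_decay_of_summable (bsa_cont c h)
    (by norm_num : (1:ℝ) < 2) (bsa_decay c h hc hh) hFs 0
  have hF : ∑' n : ℤ, 𝓕 (bsaF c h) n * fourier n ((0:ℝ) : UnitAddCircle) = ∑' n : ℤ, 𝓕 (bsaF c h) n := by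
    congr 1; ext n; simp
  rw [hF] at hP
  have hS : (((∑' ℓ : ℤ, b ^ (-ℓ) * Real.exp (-(r ^ 2 / (2 * b ^ (2 * ℓ))))) : ℝ) : ℂ) =
      ∑' n : ℤ, bsaF c h (0 + n) := by
    rw [Complex.ofReal_tsum]
    congr 1; ext n
    rw [bsaF, zero_add]
    have e : Real.exp (-(h * n)) = b ^ (-n) := by
      rw [← Real.rpow_intCast, Real.rpow_def_of_pos hb0, ← hh']; push_cast; ring_nf
    rw [e, hc']
    congr 3
    have e6 : (b ^ (-n)) ^ 2 = (b ^ (2 * n))⁻¹ := by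
      rw [← zpow_natCast, ← zpow_mul, ← zpow_neg]; congr 1; push_cast; ring
    rw [e6]
    field_simp
  have hfin : ((1 - A * ∑' ℓ : ℤ, b ^ (-ℓ) * Real.exp (-(r ^ 2 / (2 * b ^ (2 * ℓ)))) : ℝ) : ℂ) =
      - ∑' n : ℤ, (if n = 0 then 0 else (A : ℂ) * 𝓕 (bsaF c h) n : ℂ) := by
    rw [Complex.ofReal_sub, Complex.ofReal_mul, hS, hP, ← tsum_mul_left, hsum1.tsum_eq]
    simp
  rw [← Real.norm_eq_abs, ← Complex.norm_real, hfin, norm_neg]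
  exact tsum_of_norm_bounded hB hT



/-- Asymptotic (as `b → 1⁺`) uniform-in-`r` relative error bound for the bilateral
series approximation of `1/r` with `σ = 1`:
`|1 - (2 log b/√(2π)) · r · Σ_{ℓ∈ℤ} b^{-ℓ} exp(-r²/(2b^{2ℓ}))| ≲ 2√2 e^{-π²/(2 log b)}`. -/
theorem bsa_relative_error_bound :
    ∀ ε > (0 : ℝ), ∃ δ > (0 : ℝ), ∀ b : ℝ, 1 < b → b < 1 + δ → ∀ r : ℝ, 0 < r →
      |1 - (2 * Real.log b / Real.sqrt (2 * Real.pi)) * r *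
          ∑' ℓ : ℤ, b ^ (-ℓ) * Real.exp (-(r ^ 2 / (2 * b ^ (2 * ℓ))))| ≤
        (2 * Real.sqrt 2 + ε) * Real.exp (-(Real.pi ^ 2 / (2 * Real.log b))) := by
  intro ε hε
  have h2 : 0 < Real.sqrt 2 := by positivity
  refine ⟨ε / (2 * Real.sqrt 2 + ε), by positivity, fun b hb hbd r hr => ?_⟩
  refine (bsa_main b hb r hr).trans ?_
  have hh : 0 < Real.log b := Real.log_pos hb
  have hlog : Real.log b ≤ b - 1 := Real.log_le_sub_one_of_pos (by linarith)
  set q := Real.exp (-(Real.pi ^ 2 / (2 * Real.log b))) with hq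
  have hq0 : 0 < q := Real.exp_pos _
  have hqle : q ≤ Real.log b := by
    have hp : 2 ≤ Real.pi ^ 2 := by nlinarith [Real.pi_gt_three]
    have h1 : 1 / Real.log b ≤ Real.pi ^ 2 / (2 * Real.log b) := by
      rw [div_le_div_iff₀ hh (by positivity)]; nlinarith
    have h3 := Real.add_one_le_exp (Real.pi ^ 2 / (2 * Real.log b))
    rw [hq, Real.exp_neg]
    apply inv_le_of_inv_le₀ hh
    rw [← one_div]; linarith
  have hqd : q < ε / (2 * Real.sqrt 2 + ε) := by linarith
  rw [lt_div_iff₀ (by positivity)] at hqd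
  have hq1 : 0 < 1 - q := by nlinarith
  rw [mul_div_assoc', div_le_iff₀ hq1]
  nlinarith
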